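/- Fix an integer d ≥ 3 and a non-integer real ν > 0. Let φ_ν(t) = (1−t²)^ν and φ̄_ν(t) = t(1−t²)^ν for t ∈ [−1,1]. Then: (i) μ_k(φ̄_ν) = 0 for every even k; (ii) the limit of μ_k(φ̄_ν) · k^{d+2ν−1} as k → ∞ restricted to odd k exists, is nonzero, and equals the limit of μ_k(φ_ν) · k^{d+2ν−1} as k → ∞ restricted to even k. -/

import Mathlib

open Filter Asymptotics Real Set Topology

/-- Legendre polynomial of degree `k` in dimension `d` (Rodrigues formula). -/
noncomputable def legendreP (d k : ℕ) (t : ℝ) : ℝ :=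
  (-1 / 2 : ℝ) ^ k * (Real.Gamma (((d : ℝ) - 1) / 2) / Real.Gamma ((k : ℝ) + ((d : ℝ) - 1) / 2)) *
    (1 - t ^ 2) ^ ((3 - (d : ℝ)) / 2) *
    iteratedDeriv k (fun s : ℝ => (1 - s ^ 2) ^ ((k : ℝ) + ((d : ℝ) - 3) / 2)) t

/-- Surface area `ω_{p-1}` of the unit sphere in `ℝ^p`. -/
noncomputable def sphereSurface (p : ℕ) : ℝ :=
  2 * Real.pi ^ ((p : ℝ) / 2) / Real.Gamma ((p : ℝ) / 2)

/-- `μ_k(κ)`, the `k`-th Legendre coefficient of `κ` in dimension `d`. -/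
noncomputable def legendreCoeff (d k : ℕ) (κ : ℝ → ℝ) : ℝ :=
  (sphereSurface (d - 1) / sphereSurface d) *
    ∫ t in (-1 : ℝ)..1, κ t * legendreP d k t * (1 - t ^ 2) ^ (((d : ℝ) - 3) / 2)


/-- Iterated derivatives of `(1-s^2)^a`. -/
noncomputable def hh (j : ℕ) (a : ℝ) : ℝ → ℝ :=
  iteratedDeriv j (fun s : ℝ => (1 - s ^ 2) ^ a)

lemma one_sub_pos {t : ℝ} (ht : t ∈ Ioo (-1 : ℝ) 1) : 0 < 1 - t ^ 2 := by
  nlinarith [ht.1, ht.2]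

lemma hh_hasDeriv (j : ℕ) (a : ℝ) {t : ℝ} (ht : t ∈ Ioo (-1 : ℝ) 1) :
    HasDerivAt (hh j a) (hh (j + 1) a t) t := by
  have h1 : ContDiffAt ℝ (j + 1 : ℕ) (fun s : ℝ => (1 - s ^ 2) ^ a) t := by
    apply ContDiffAt.rpow_const_of_ne
    · fun_prop
    · exact (one_sub_pos ht).ne'
  have h2 : DifferentiableAt ℝ (hh j a) t := by
    have h := h1.differentiableAt_iteratedFDeriv (m := j) (by exact_mod_cast Nat.lt_succ_self j)
    unfold hh
    rw [iteratedDeriv_eq_equiv_comp]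
    exact (ContinuousMultilinearMap.piFieldEquiv ℝ (Fin j) ℝ).symm.toContinuousLinearEquiv
      |>.differentiableAt.comp t h
  have h3 : hh (j + 1) a t = deriv (hh j a) t := by
    unfold hh; rw [iteratedDeriv_succ]
  rw [h3]; exact h2.hasDerivAt

lemma hh_zero (a t : ℝ) : hh 0 a t = (1 - t ^ 2) ^ a := by simp [hh]

lemma hasDeriv_w (a : ℝ) {t : ℝ} (ht : t ∈ Ioo (-1 : ℝ) 1) :
    HasDerivAt (fun s : ℝ => (1 - s ^ 2) ^ a) (-2 * a * t * (1 - t ^ 2) ^ (a - 1)) t := by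
  have h : HasDerivAt (fun s : ℝ => 1 - s ^ 2) (-(2 * t)) t := by
    simpa using ((hasDerivAt_id t).pow 2).const_sub 1
  convert h.rpow_const (p := a) (Or.inl (one_sub_pos ht).ne') using 1
  ring

lemma eq_of_eqOn {f g : ℝ → ℝ} {f' g' t : ℝ} (ht : t ∈ Ioo (-1 : ℝ) 1)
    (h : ∀ s ∈ Ioo (-1 : ℝ) 1, f s = g s) (hf : HasDerivAt f f' t) (hg : HasDerivAt g g' t) :
    f' = g' := by
  have : f =ᶠ[𝓝 t] g := by
    filter_upwards [Ioo_mem_nhds ht.1 ht.2] with s hs using h s hs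
  exact (hf.congr_of_eventuallyEq this.symm).unique hg

lemma hh_d1 (j : ℕ) (a : ℝ) {t : ℝ} (ht : t ∈ Ioo (-1 : ℝ) 1) :
    HasDerivAt (fun s => (j : ℝ) * hh (j - 1) a s) (j * hh j a t) t := by
  rcases j with _ | j
  · simpa using hasDerivAt_const t (0 : ℝ)
  · exact (hh_hasDeriv j a ht).const_mul _

lemma hh_d2 (j : ℕ) (a : ℝ) {t : ℝ} (ht : t ∈ Ioo (-1 : ℝ) 1) :
    HasDerivAt (fun s => (j : ℝ) * (j - 1) * hh (j - 2) a s)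
      (j * (j - 1) * hh (j - 1) a t) t := by
  rcases j with _ | _ | j
  · simpa using hasDerivAt_const t (0 : ℝ)
  · simpa using hasDerivAt_const t (0 : ℝ)
  · exact (hh_hasDeriv j a ht).const_mul _

lemma rel2 (a : ℝ) (j : ℕ) : ∀ t ∈ Ioo (-1 : ℝ) 1,
    hh (j + 1) a t = -2 * a * (t * hh j (a - 1) t + j * hh (j - 1) (a - 1) t) := by
  induction j with
  | zero =>
    intro t ht
    have h1 := hh_hasDeriv 0 a ht
    have h2 := hasDeriv_w a ht
    have := eq_of_eqOn ht (fun s _ => hh_zero a s) h1 h2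
    rw [this, hh_zero]; push_cast; ring
  | succ j ih =>
    intro t ht
    have h1 := hh_hasDeriv (j + 1) a ht
    have h2 := ((((hasDerivAt_id t).mul (hh_hasDeriv j (a - 1) ht)).add
      (hh_d1 j (a - 1) ht)).const_mul (-2 * a))
    have := eq_of_eqOn ht ih h1 h2
    rw [this]; simp only [id, Nat.add_sub_cancel]; push_cast; ring

lemma rel3 (a : ℝ) (j : ℕ) : ∀ t ∈ Ioo (-1 : ℝ) 1,
    hh j a t = (1 - t ^ 2) * hh j (a - 1) t - 2 * t * (j * hh (j - 1) (a - 1) t)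
      - j * (j - 1) * hh (j - 2) (a - 1) t := by
  induction j with
  | zero =>
    intro t ht
    have := one_sub_pos ht
    rw [hh_zero, hh_zero, Real.rpow_sub_one this.ne']
    field_simp; simp
  | succ j ih =>
    intro t ht
    have h1 := hh_hasDeriv j a ht
    have hw : HasDerivAt (fun s : ℝ => 1 - s ^ 2) (-(2 * t)) t := by
      simpa using ((hasDerivAt_id t).pow 2).const_sub 1
    have h2t : HasDerivAt (fun s : ℝ => 2 * s) 2 t := by
      simpa using (hasDerivAt_id t).const_mul (2 : ℝ)
    have h2 := (((hw.mul (hh_hasDeriv j (a - 1) ht)).sub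
      (h2t.mul (hh_d1 j (a - 1) ht))).sub (hh_d2 j (a - 1) ht))
    have := eq_of_eqOn ht ih h1 h2
    rw [this]
    have e : j + 1 - 2 = j - 1 := by omega
    rw [e]; push_cast; simp; ring

/-- Rodrigues functions. -/
noncomputable def gg (l : ℝ) (k : ℕ) : ℝ → ℝ := hh k (k + l)

lemma gg_rodr (l : ℝ) (k : ℕ) {t : ℝ} (ht : t ∈ Ioo (-1 : ℝ) 1) :
    gg l (k + 1) t = -2 * (k + 1 + l) * (t * gg l k t + k * hh (k - 1) (k + l) t) := by
  have := rel2 (((k + 1 : ℕ) : ℝ) + l) k t ht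
  have e : ((k + 1 : ℕ) : ℝ) + l - 1 = k + l := by push_cast; ring
  rw [e] at this
  unfold gg; rw [this]; push_cast; ring

lemma gg_B (l : ℝ) (hl : 0 ≤ l) (k : ℕ) {t : ℝ} (ht : t ∈ Ioo (-1 : ℝ) 1) :
    (1 - t ^ 2) * hh (k + 1) (k + l) t =
      (k + 1) * t * gg l k t + (k + 1 + 2 * l) / (2 * (k + 1 + l)) * gg l (k + 1) t := by
  have h2 := gg_rodr l k ht
  have h3 := rel3 (((k + 1 : ℕ) : ℝ) + l) (k + 1) t ht
  have e : ((k + 1 : ℕ) : ℝ) + l - 1 = k + l := by push_cast; ring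
  have e' : k + 1 - 2 = k - 1 := by omega
  have e'' : gg l (k + 1) t = hh (k + 1) (((k + 1 : ℕ) : ℝ) + l) t := rfl
  have e3 : hh (k + 1 - 1) (k + l) t = gg l k t := rfl
  rw [e, e', ← e'', e3] at h3
  push_cast at h3
  have hp : (k : ℝ) + 1 + l ≠ 0 := by positivity
  field_simp
  linear_combination (2 * (k + 1 + l)) * (-h3) + (k + 1) * h2

lemma gg_A (l : ℝ) (k : ℕ) {t : ℝ} (ht : t ∈ Ioo (-1 : ℝ) 1) :
    hh (k + 1 + 1) ((k + 1 : ℕ) + l) t =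
      -2 * (k + 1 + l) * ((k + 1) * gg l k t + t * hh (k + 1) (k + l) t) := by
  have h1 : HasDerivAt (gg l (k + 1)) _ t := hh_hasDeriv (k + 1) ((k + 1 : ℕ) + l) ht
  have h0 : HasDerivAt (gg l k) _ t := hh_hasDeriv k (k + l) ht
  have h2 := ((((hasDerivAt_id t).mul h0).add
      (hh_d1 k (k + l) ht)).const_mul (-2 * (k + 1 + l)))
  have := eq_of_eqOn ht (fun s hs => gg_rodr l k hs) h1 h2
  rw [this]; simp; left
  unfold gg; ring

lemma gg_three (l : ℝ) (hl : 0 ≤ l) (k : ℕ) {t : ℝ} (ht : t ∈ Ioo (-1 : ℝ) 1) :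
    (k + 2 + 2 * l) / (2 * (k + 2 + l)) * gg l (k + 2) t =
      -(2 * (k + 1 + l) * (k + 1)) * gg l k t - (2 * k + 3 + 2 * l) * (t * gg l (k + 1) t) := by
  have hA := gg_A l k ht
  have hB := gg_B l hl k ht
  have hB' := gg_B l hl (k + 1) ht
  push_cast at hA hB'
  have e : (k : ℝ) + 1 + 1 = k + 2 := by ring
  rw [e] at hB'
  have hp : (k : ℝ) + 1 + l ≠ 0 := by positivity
  have key : (k + 2 + 2 * l) / (2 * (k + 2 + l)) * gg l (k + 2) t =
     (1 - t ^ 2) * hh (k + 1 + 1) (k + 1 + l) t - (k + 2) * t * gg l (k + 1) t := by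
    rw [hB']; ring
  rw [key, hA]
  have : (1 - t ^ 2) * (-2 * (k + 1 + l) * ((k + 1) * gg l k t + t * hh (k + 1) (k + l) t))
    = -2 * (k + 1 + l) * ((1 - t ^ 2) * (k + 1) * gg l k t
      + t * ((1 - t ^ 2) * hh (k + 1) (k + l) t)) := by ring
  rw [this, hB]
  field_simp
  ring

lemma gg_zero (l t : ℝ) : gg l 0 t = (1 - t ^ 2) ^ l := by simp [gg, hh_zero]

lemma gg_one (l : ℝ) {t : ℝ} (ht : t ∈ Ioo (-1 : ℝ) 1) :
    gg l 1 t = -2 * (1 + l) * (t * gg l 0 t) := by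
  have := gg_rodr l 0 ht
  simpa using this

lemma cont_w {a : ℝ} (ha : 0 ≤ a) : Continuous (fun t : ℝ => (1 - t ^ 2) ^ a) := by
  apply Continuous.rpow_const
  · fun_prop
  · intro x; right; exact ha

lemma gg_ext (l : ℝ) (hl : 0 ≤ l) (k : ℕ) :
    (∃ F : ℝ → ℝ, Continuous F ∧ ∀ t ∈ Ioo (-1 : ℝ) 1, gg l k t = F t) ∧
    (∃ F : ℝ → ℝ, Continuous F ∧ ∀ t ∈ Ioo (-1 : ℝ) 1, gg l (k + 1) t = F t) := by
  induction k with
  | zero =>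
    refine ⟨⟨_, cont_w hl, fun t _ => gg_zero l t⟩,
      ⟨fun t => -2 * (1 + l) * (t * (1 - t ^ 2) ^ l), ?_, fun t ht => ?_⟩⟩
    · have := cont_w hl
      fun_prop
    · rw [zero_add, gg_one l ht, gg_zero]
  | succ k ih =>
    refine ⟨ih.2, ?_⟩
    obtain ⟨⟨F, hF, hF'⟩, ⟨F1, hF1, hF1'⟩⟩ := ih
    refine ⟨fun t => (-(2 * (k + 1 + l) * (k + 1)) * F t - (2 * k + 3 + 2 * l) * (t * F1 t)) /
      ((k + 2 + 2 * l) / (2 * (k + 2 + l))), by fun_prop, fun t ht => ?_⟩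
    have := gg_three l hl k ht
    rw [hF' t ht, hF1' t ht] at this
    show gg l (k + 2) t = _ / _
    rw [← this]
    have : (k + 2 + 2 * l) / (2 * (k + 2 + l)) ≠ 0 := by positivity
    field_simp

/-- continuous extension of `gg` -/
noncomputable def ff (l : ℝ) (hl : 0 ≤ l) (k : ℕ) : ℝ → ℝ := (gg_ext l hl k).1.choose

lemma ff_cont (l : ℝ) (hl : 0 ≤ l) (k : ℕ) : Continuous (ff l hl k) :=
  (gg_ext l hl k).1.choose_spec.1

lemma ff_eq (l : ℝ) (hl : 0 ≤ l) (k : ℕ) {t : ℝ} (ht : t ∈ Ioo (-1 : ℝ) 1) :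
    gg l k t = ff l hl k t :=
  (gg_ext l hl k).1.choose_spec.2 t ht

lemma integral_congr_Ioo {f g : ℝ → ℝ} (h : ∀ t ∈ Ioo (-1 : ℝ) 1, f t = g t) :
    ∫ t in (-1 : ℝ)..1, f t = ∫ t in (-1 : ℝ)..1, g t := by
  rw [intervalIntegral.integral_of_le (by norm_num), intervalIntegral.integral_of_le (by norm_num),
    MeasureTheory.integral_Ioc_eq_integral_Ioo, MeasureTheory.integral_Ioc_eq_integral_Ioo]
  exact MeasureTheory.setIntegral_congr_fun measurableSet_Ioo h

/-- the even-type integrals -/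
noncomputable def jj (ν l : ℝ) (hl : 0 ≤ l) (k : ℕ) : ℝ :=
  ∫ t in (-1 : ℝ)..1, (1 - t ^ 2) ^ ν * ff l hl k t

/-- the odd-type integrals -/
noncomputable def kk (ν l : ℝ) (hl : 0 ≤ l) (k : ℕ) : ℝ :=
  ∫ t in (-1 : ℝ)..1, (1 - t ^ 2) ^ ν * (t * ff l hl k t)

lemma jj_int (ν l : ℝ) (hν : 0 < ν) (hl : 0 ≤ l) (k : ℕ) :
    Continuous (fun t : ℝ => (1 - t ^ 2) ^ ν * ff l hl k t) := by
  have := cont_w hν.le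
  have := ff_cont l hl k
  fun_prop

lemma kk_int (ν l : ℝ) (hν : 0 < ν) (hl : 0 ≤ l) (k : ℕ) :
    Continuous (fun t : ℝ => (1 - t ^ 2) ^ ν * (t * ff l hl k t)) := by
  have := cont_w hν.le
  have := ff_cont l hl k
  fun_prop

lemma ibp (ν l : ℝ) (hν : 0 < ν) (hl : 0 ≤ l) (k : ℕ) :
    (2 * ν + 1 - k) * kk ν l hl k = (k + 1 + 2 * l) / (2 * (k + 1 + l)) * jj ν l hl (k + 1) := by
  have hc : ContinuousOn (fun t : ℝ => (1 - t ^ 2) ^ (ν + 1) * ff l hl k t) (Icc (-1) 1) := by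
    have := cont_w (by linarith : 0 ≤ ν + 1)
    have := ff_cont l hl k
    apply Continuous.continuousOn
    fun_prop
  have h := intervalIntegral.integral_eq_sub_of_hasDerivAt_of_le (a := (-1 : ℝ)) (b := 1)
    (by norm_num) hc
    (f' := fun t => (k + 1 + 2 * l) / (2 * (k + 1 + l)) * ((1 - t ^ 2) ^ ν * ff l hl (k + 1) t)
      - (2 * ν + 1 - k) * ((1 - t ^ 2) ^ ν * (t * ff l hl k t))) ?_ ?_
  · rw [intervalIntegral.integral_sub, intervalIntegral.integral_const_mul,
      intervalIntegral.integral_const_mul] at h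
    · have e : (0 : ℝ) ^ (ν + 1) = 0 := Real.zero_rpow (by linarith)
      norm_num [e] at h
      unfold kk jj
      linarith
    · exact ((jj_int ν l hν hl (k + 1)).const_mul _).intervalIntegrable _ _
    · exact ((kk_int ν l hν hl k).const_mul _).intervalIntegrable _ _
  · intro t ht
    have h1 := hasDeriv_w (ν + 1) ht
    have h0 : HasDerivAt (gg l k) _ t := hh_hasDeriv k (k + l) ht
    have h0' : HasDerivAt (ff l hl k) (hh (k + 1) (k + l) t) t := by
      apply h0.congr_of_eventuallyEq
      filter_upwards [Ioo_mem_nhds ht.1 ht.2] with s hs using (ff_eq l hl k hs).symm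
    refine (h1.mul h0').congr_deriv ?_
    have hB := gg_B l hl k ht
    rw [ff_eq l hl k ht, ff_eq l hl (k + 1) ht] at hB
    have e : ν + 1 - 1 = ν := by ring
    rw [e, Real.rpow_add_one (one_sub_pos ht).ne', mul_assoc ((1 - t ^ 2) ^ ν), hB]
    ring
  · apply Continuous.intervalIntegrable
    exact ((jj_int ν l hν hl (k + 1)).const_mul _).sub ((kk_int ν l hν hl k).const_mul _)

lemma int_three (ν l : ℝ) (hν : 0 < ν) (hl : 0 ≤ l) (k : ℕ) :
    (k + 2 + 2 * l) / (2 * (k + 2 + l)) * jj ν l hl (k + 2) =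
      -(2 * (k + 1 + l) * (k + 1)) * jj ν l hl k - (2 * k + 3 + 2 * l) * kk ν l hl (k + 1) := by
  unfold jj kk
  rw [← intervalIntegral.integral_const_mul, ← intervalIntegral.integral_const_mul,
    ← intervalIntegral.integral_const_mul, ← intervalIntegral.integral_sub]
  · apply integral_congr_Ioo
    intro t ht
    have := gg_three l hl k ht
    rw [ff_eq l hl k ht, ff_eq l hl (k + 1) ht, ff_eq l hl (k + 2) ht] at this
    linear_combination (1 - t ^ 2) ^ ν * this
  · exact ((jj_int ν l hν hl k).const_mul _).intervalIntegrable _ _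
  · exact ((kk_int ν l hν hl (k + 1)).const_mul _).intervalIntegrable _ _

lemma kk_succ (ν l : ℝ) (hν : 0 < ν) (hl : 0 ≤ l) (k : ℕ) :
    (k + 3 + 2 * l + 2 * ν) * kk ν l hl (k + 1) = -(2 * (k + 1 + l) * (k + 1)) * jj ν l hl k := by
  have h1 := ibp ν l hν hl (k + 1)
  have h2 := int_three ν l hν hl k
  push_cast at h1
  have e : (k : ℝ) + 1 + 1 = k + 2 := by ring
  rw [e] at h1
  rw [show k + 1 + 1 = k + 2 from rfl, h2] at h1
  linarith

lemma kk_zero (ν l : ℝ) (hν : 0 < ν) (hl : 0 ≤ l) : kk ν l hl 0 = 0 ∧ jj ν l hl 1 = 0 := by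
  have h1 := ibp ν l hν hl 0
  have h2 : jj ν l hl 1 = -2 * (1 + l) * kk ν l hl 0 := by
    unfold jj kk
    rw [← intervalIntegral.integral_const_mul]
    apply integral_congr_Ioo
    intro t ht
    have := gg_one l ht
    rw [ff_eq l hl 0 ht, ff_eq l hl 1 ht] at this
    simp only [this]; ring
  have hp : (1 : ℝ) + l ≠ 0 := by positivity
  simp only [zero_add, h2, Nat.cast_zero] at h1
  field_simp at h1
  have : kk ν l hl 0 * (2 * ν + 2 + 2 * l) = 0 := by linarith
  have h3 : kk ν l hl 0 = 0 := by
    rcases mul_eq_zero.1 this with h | h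
    · exact h
    · exfalso; linarith
  exact ⟨h3, by rw [h2, h3]; ring⟩

lemma jj_zero_pos (ν l : ℝ) (hν : 0 < ν) (hl : 0 ≤ l) : 0 < jj ν l hl 0 := by
  unfold jj
  apply intervalIntegral.intervalIntegral_pos_of_pos_on
  · exact (jj_int ν l hν hl 0).intervalIntegrable _ _
  · intro t ht
    rw [← ff_eq l hl 0 ht, gg_zero]
    have := one_sub_pos ht
    positivity
  · norm_num

lemma jj_odd (ν l : ℝ) (hν : 0 < ν) (hl : 0 ≤ l) (n : ℕ) : jj ν l hl (2 * n + 1) = 0 := by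
  induction n with
  | zero => exact (kk_zero ν l hν hl).2
  | succ n ih =>
    have h1 := kk_succ ν l hν hl (2 * n + 1)
    rw [ih, mul_zero] at h1
    have h2 := ibp ν l hν hl (2 * n + 1 + 1)
    have hp0 : (((2 * n + 1 : ℕ) : ℝ) + 3 + 2 * l + 2 * ν) ≠ 0 := by positivity
    have hk : kk ν l hl (2 * n + 1 + 1) = 0 := by
      rcases mul_eq_zero.1 h1 with h | h
      · exact absurd h hp0
      · exact h
    rw [hk, mul_zero] at h2
    have hp : (((2 * n + 1 + 1 : ℕ) : ℝ) + 1 + 2 * l) / (2 * (((2 * n + 1 + 1 : ℕ) : ℝ) + 1 + l)) ≠ 0 := by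
      positivity
    exact (mul_eq_zero.1 h2.symm).resolve_left hp

lemma kk_even (ν l : ℝ) (hν : 0 < ν) (hl : 0 ≤ l) (k : ℕ) (hk : Even k) : kk ν l hl k = 0 := by
  obtain ⟨n, rfl⟩ := hk.exists_two_nsmul
  rcases n with _ | n
  · exact (kk_zero ν l hν hl).1
  · have h1 := kk_succ ν l hν hl (2 * n + 1)
    rw [jj_odd ν l hν hl, mul_zero] at h1
    have hp : (((2 * n + 1 : ℕ) : ℝ) + 3 + 2 * l + 2 * ν) ≠ 0 := by positivity
    exact (mul_eq_zero.1 h1).resolve_left hp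

/-- Rodrigues normalisation constant. -/
noncomputable def cc (l : ℝ) (k : ℕ) : ℝ :=
  (-1 / 2 : ℝ) ^ k * (Real.Gamma (l + 1) / Real.Gamma (k + (l + 1)))

lemma cc_succ (l : ℝ) (hl : 0 ≤ l) (k : ℕ) :
    -(2 * (k + 1 + l)) * cc l (k + 1) = cc l k := by
  unfold cc
  have e : (((k + 1 : ℕ) : ℝ) + (l + 1)) = (k + (l + 1)) + 1 := by push_cast; ring
  have hp : (k : ℝ) + (l + 1) ≠ 0 := by positivity
  rw [e, Real.Gamma_add_one hp]
  have hg : Real.Gamma ((k : ℝ) + (l + 1)) ≠ 0 := (Real.Gamma_pos_of_pos (by positivity)).ne'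
  have hp' : (k : ℝ) + 1 + l ≠ 0 := by positivity
  have hp2 : (k : ℝ) + (l + 1) = k + 1 + l := by ring
  rw [hp2] at hg ⊢
  rw [pow_succ]
  field_simp

lemma coeff_eq (d : ℕ) (l : ℝ) (hl : 0 ≤ l) (hdl : (d : ℝ) = 2 * l + 3) (k : ℕ) (κ : ℝ → ℝ) :
    legendreCoeff d k κ = (sphereSurface (d - 1) / sphereSurface d) * (cc l k *
      ∫ t in (-1 : ℝ)..1, κ t * ff l hl k t) := by
  unfold legendreCoeff
  congr 1
  rw [← intervalIntegral.integral_const_mul]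
  apply integral_congr_Ioo
  intro t ht
  rw [← ff_eq l hl k ht]
  have e1 : ((d : ℝ) - 1) / 2 = l + 1 := by rw [hdl]; ring
  have e2 : ((d : ℝ) - 3) / 2 = l := by rw [hdl]; ring
  have e3 : (3 - (d : ℝ)) / 2 = -l := by rw [hdl]; ring
  unfold legendreP cc gg hh
  rw [e1, e2, e3]
  have hw := one_sub_pos ht
  have : (1 - t ^ 2) ^ (-l) * (1 - t ^ 2) ^ l = 1 := by
    rw [← Real.rpow_add hw]; simp
  linear_combination (κ t * ((-1 / 2 : ℝ) ^ k * (Real.Gamma (l + 1) / Real.Gamma (k + (l + 1)))) *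
    iteratedDeriv k (fun s : ℝ => (1 - s ^ 2) ^ ((k : ℝ) + l)) t) * this

/-- scaled coefficients -/
noncomputable def uu (ν l : ℝ) (hl : 0 ≤ l) (k : ℕ) : ℝ := cc l k * jj ν l hl k

/-- scaled coefficients -/
noncomputable def vv (ν l : ℝ) (hl : 0 ≤ l) (k : ℕ) : ℝ := cc l k * kk ν l hl k

lemma vv_succ (ν l : ℝ) (hν : 0 < ν) (hl : 0 ≤ l) (k : ℕ) :
    vv ν l hl (k + 1) = (k + 1) / (k + 3 + 2 * l + 2 * ν) * uu ν l hl k := by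
  have h1 := kk_succ ν l hν hl k
  have h2 := cc_succ l hl k
  unfold vv uu
  have hp : (k : ℝ) + 3 + 2 * l + 2 * ν ≠ 0 := by positivity
  field_simp
  rw [← h2]
  linear_combination cc l (k + 1) * h1

lemma uu_succ (ν l : ℝ) (hν : 0 < ν) (hl : 0 ≤ l) (k : ℕ) :
    uu ν l hl (k + 2) = (k - 2 * ν) / (k + 2 + 2 * l) * vv ν l hl (k + 1) := by
  have h1 := ibp ν l hν hl (k + 1)
  have h2 := cc_succ l hl (k + 1)
  unfold vv uu
  rw [← h2]
  push_cast at *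
  rw [show k + 1 + 1 = k + 2 from rfl] at *
  have e : (k : ℝ) + 1 + 1 = k + 2 := by ring
  rw [e] at h1 ⊢
  have hp : (k : ℝ) + 2 + 2 * l ≠ 0 := by positivity
  have hp' : (k : ℝ) + 2 + l ≠ 0 := by positivity
  field_simp at h1 ⊢
  linear_combination (-cc l (k + 2)) * h1

lemma uu_step (ν l : ℝ) (hν : 0 < ν) (hl : 0 ≤ l) (m : ℕ) :
    uu ν l hl (2 * (m + 1)) = ((-ν + m) * (1 / 2 + m)) / ((l + 1 + m) * (l + 3 / 2 + ν + m)) *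
      uu ν l hl (2 * m) := by
  have h1 := uu_succ ν l hν hl (2 * m)
  rw [vv_succ ν l hν hl (2 * m)] at h1
  rw [show 2 * (m + 1) = 2 * m + 2 by ring, h1]
  push_cast
  have hp : l + 1 + (m : ℝ) ≠ 0 := by positivity
  have hp' : l + 3 / 2 + ν + (m : ℝ) ≠ 0 := by positivity
  have hq : 2 * (m : ℝ) + 2 + 2 * l ≠ 0 := by positivity
  have hq' : 2 * (m : ℝ) + 3 + 2 * l + 2 * ν ≠ 0 := by positivity
  rw [← mul_assoc]
  congr 1
  rw [div_mul_div_comm, div_eq_div_iff (by positivity) (by positivity)]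
  ring

lemma uu_prod (ν l : ℝ) (hν : 0 < ν) (hl : 0 ≤ l) (m : ℕ) :
    uu ν l hl (2 * m) = uu ν l hl 0 * (((∏ j ∈ Finset.range m, (-ν + j)) *
      ∏ j ∈ Finset.range m, (1 / 2 + (j : ℝ))) / ((∏ j ∈ Finset.range m, (l + 1 + j)) *
      ∏ j ∈ Finset.range m, (l + 3 / 2 + ν + j))) := by
  induction m with
  | zero => simp
  | succ m ih =>
    rw [uu_step ν l hν hl, ih]
    simp only [Finset.prod_range_succ]
    rw [mul_left_comm, div_mul_div_comm]
    congr 2 <;> ring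

lemma prod_eq_GammaSeq (s : ℝ) (n : ℕ) (hn : 0 < n) (h : ∀ j : ℕ, s + j ≠ 0) :
    ∏ j ∈ Finset.range (n + 1), (s + j) = (n : ℝ) ^ s * (n.factorial : ℝ) / Real.GammaSeq s n := by
  unfold Real.GammaSeq
  have h1 : (n : ℝ) ^ s * (n.factorial : ℝ) ≠ 0 := by positivity
  have h2 : ∏ j ∈ Finset.range (n + 1), (s + (j : ℝ)) ≠ 0 :=
    Finset.prod_ne_zero_iff.2 fun j _ => h j
  field_simp

lemma uu_lim (ν l : ℝ) (hν : 0 < ν) (hνn : ∀ n : ℤ, ν ≠ (n : ℝ)) (hl : 0 ≤ l) :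
    Tendsto (fun n : ℕ => uu ν l hl (2 * (n + 1)) * (n : ℝ) ^ (2 * l + 2 + 2 * ν)) atTop
      (𝓝 (uu ν l hl 0 * ((Real.Gamma (l + 1) * Real.Gamma (l + 3 / 2 + ν)) /
        (Real.Gamma (-ν) * Real.Gamma (1 / 2))))) := by
  have hn1 : ∀ j : ℕ, -ν + j ≠ 0 := fun j h => hνn j (by push_cast; linarith)
  have hG1 : Real.Gamma (-ν) ≠ 0 := by
    apply Real.Gamma_ne_zero
    intro m h
    exact hνn m (by push_cast; linarith)
  have hG2 : Real.Gamma (1 / 2) ≠ 0 := (Real.Gamma_pos_of_pos (by norm_num)).ne'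
  have hlim := (((Real.GammaSeq_tendsto_Gamma (l + 1)).mul
    (Real.GammaSeq_tendsto_Gamma (l + 3 / 2 + ν))).div
    ((Real.GammaSeq_tendsto_Gamma (-ν)).mul (Real.GammaSeq_tendsto_Gamma (1 / 2)))
    (mul_ne_zero hG1 hG2)).const_mul (uu ν l hl 0)
  refine hlim.congr' ?_
  filter_upwards [eventually_gt_atTop 0] with n hn
  rw [uu_prod ν l hν hl, prod_eq_GammaSeq _ n hn hn1,
    prod_eq_GammaSeq _ n hn (fun j => by positivity), prod_eq_GammaSeq _ n hn (fun j => by positivity),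
    prod_eq_GammaSeq _ n hn (fun j => by positivity)]
  have hn' : (0 : ℝ) < n := by exact_mod_cast hn
  have key : (n : ℝ) ^ (l + 1) * (n : ℝ) ^ (l + 3 / 2 + ν) =
      (n : ℝ) ^ (-ν) * (n : ℝ) ^ (1 / 2 : ℝ) * (n : ℝ) ^ (2 * l + 2 + 2 * ν) := by
    rw [← Real.rpow_add hn', ← Real.rpow_add hn', ← Real.rpow_add hn']
    congr 1; ring
  have hA : (n : ℝ) ^ (l + 1) ≠ 0 := (Real.rpow_pos_of_pos hn' _).ne'
  have hB : (n : ℝ) ^ (l + 3 / 2 + ν) ≠ 0 := (Real.rpow_pos_of_pos hn' _).ne'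
  have hf : (n.factorial : ℝ) ≠ 0 := by positivity
  simp only [Pi.div_apply, Pi.mul_apply]
  rw [mul_assoc]
  congr 1
  generalize (n : ℝ) ^ (l + 1) = A at *
  generalize (n : ℝ) ^ (l + 3 / 2 + ν) = B at *
  generalize (n : ℝ) ^ (-ν) = A' at *
  generalize (n : ℝ) ^ (1 / 2 : ℝ) = B' at *
  generalize (n : ℝ) ^ (2 * l + 2 + 2 * ν) = Z at *
  generalize Real.GammaSeq (l + 1) n = g1
  generalize Real.GammaSeq (l + 3 / 2 + ν) n = g2
  generalize Real.GammaSeq (-ν) n = g3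
  generalize Real.GammaSeq (1 / 2) n = g4
  generalize (n.factorial : ℝ) = f at *
  calc g1 * g2 / (g3 * g4) = (A * B) / (A * B) * (g1 * g2 / (g3 * g4)) := by
        rw [div_self (mul_ne_zero hA hB), one_mul]
    _ = (A' * B' * Z) / (A * B) * (g1 * g2 / (g3 * g4)) := by rw [key]
    _ = _ := by
      simp only [div_eq_mul_inv, mul_inv, inv_inv]
      field_simp

lemma lin_ratio (a b : ℝ) (E : ℝ) (hE : 0 ≤ E) (ha : 0 ≤ a) (hb : 0 ≤ b) :
    Tendsto (fun n : ℕ => (a * n + b) ^ E / (n : ℝ) ^ E) atTop (𝓝 (a ^ E)) := by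
  have h1 : Tendsto (fun n : ℕ => a + b / (n : ℝ)) atTop (𝓝 a) := by
    simpa using tendsto_const_nhds.add (tendsto_const_div_atTop_nhds_zero_nat b)
  refine (h1.rpow_const (p := E) (Or.inr hE)).congr' ?_
  filter_upwards [eventually_gt_atTop 0] with n hn
  have hn' : (0 : ℝ) < n := by exact_mod_cast hn
  rw [← Real.div_rpow (by positivity) hn'.le]
  congr 1
  field_simp

lemma tendsto_inf_of_seq (f : ℕ → ℝ) (S : Set ℕ) (C : ℝ) (r : ℕ)
    (hS : ∀ k ∈ S, r ≤ k → ∃ n, k = 2 * n + r)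
    (h : Tendsto (fun n : ℕ => f (2 * n + r)) atTop (𝓝 C)) :
    Tendsto f (atTop ⊓ 𝓟 S) (𝓝 C) := by
  have h1 : Tendsto (fun k : ℕ => (k - r) / 2) (atTop ⊓ 𝓟 S) atTop := by
    apply Tendsto.mono_left _ inf_le_left
    exact (Nat.tendsto_div_const_atTop (by norm_num)).comp (tendsto_sub_atTop_nat r)
  refine (h.comp h1).congr' ?_
  have : ∀ᶠ k in atTop ⊓ 𝓟 S, r ≤ k := (eventually_ge_atTop r).filter_mono inf_le_left
  have h3 : ∀ᶠ k in atTop ⊓ 𝓟 S, k ∈ S := mem_inf_of_right (mem_principal_self S)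
  filter_upwards [this, h3] with k hk hkS
  obtain ⟨n, rfl⟩ := hS k hkS hk
  simp

/-- Legendre coefficients of `φ̄_ν(t) = t(1-t²)^ν`: vanishing for even `k`, and along odd `k`
they have the same asymptotic decay `k^{-d-2ν+1}` (with the same limit constant) as the
coefficients of `φ_ν(t) = (1-t²)^ν` along even `k`. -/
theorem phi_bar_nu_decay (d : ℕ) (hd : 3 ≤ d) (ν : ℝ) (hν : 0 < ν)
    (hνnonint : ∀ n : ℤ, ν ≠ (n : ℝ)) :
    (∀ k : ℕ, Even k → legendreCoeff d k (fun t => t * (1 - t ^ 2) ^ ν) = 0) ∧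
    (∃ C : ℝ, C ≠ 0 ∧
      Tendsto (fun k : ℕ =>
          legendreCoeff d k (fun t => t * (1 - t ^ 2) ^ ν) * (k : ℝ) ^ ((d : ℝ) + 2 * ν - 1))
        (atTop ⊓ 𝓟 {k | Odd k}) (𝓝 C) ∧
      Tendsto (fun k : ℕ =>
          legendreCoeff d k (fun t => (1 - t ^ 2) ^ ν) * (k : ℝ) ^ ((d : ℝ) + 2 * ν - 1))
        (atTop ⊓ 𝓟 {k | Even k}) (𝓝 C)) := by
  obtain ⟨l, hl, hdl⟩ : ∃ l : ℝ, 0 ≤ l ∧ (d : ℝ) = 2 * l + 3 := by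
    have : (3 : ℝ) ≤ d := by exact_mod_cast hd
    exact ⟨((d : ℝ) - 3) / 2, by linarith, by ring⟩
  set S := sphereSurface (d - 1) / sphereSurface d with hS
  have hS0 : S ≠ 0 := by
    have h1 : ∀ p : ℕ, 0 < p → sphereSurface p ≠ 0 := by
      intro p hp
      have hp' : (0 : ℝ) < p := by exact_mod_cast hp
      have : 0 < Real.Gamma ((p : ℝ) / 2) := Real.Gamma_pos_of_pos (by positivity)
      unfold sphereSurface
      positivity
    exact div_ne_zero (h1 _ (by omega)) (h1 _ (by omega))
  have hu : ∀ k, legendreCoeff d k (fun t => (1 - t ^ 2) ^ ν) = S * uu ν l hl k := fun k => by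
    rw [coeff_eq d l hl hdl]; rfl
  have hv : ∀ k, legendreCoeff d k (fun t => t * (1 - t ^ 2) ^ ν) = S * vv ν l hl k := fun k => by
    rw [coeff_eq d l hl hdl]
    unfold vv kk
    congr 3
    ext t; ring
  have hE : (d : ℝ) + 2 * ν - 1 = 2 * l + 2 + 2 * ν := by rw [hdl]; ring
  have hE0 : 0 ≤ 2 * l + 2 + 2 * ν := by positivity
  refine ⟨fun k hk => ?_, ?_⟩
  · rw [hv, vv, kk_even ν l hν hl k hk]; ring
  · simp only [hu, hv, hE]
    have hlim := uu_lim ν l hν hνnonint hl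
    set E := 2 * l + 2 + 2 * ν with hEdef
    set L := uu ν l hl 0 * ((Real.Gamma (l + 1) * Real.Gamma (l + 3 / 2 + ν)) /
        (Real.Gamma (-ν) * Real.Gamma (1 / 2))) with hL
    have hL0 : L ≠ 0 := by
      have hG1 : Real.Gamma (-ν) ≠ 0 := by
        apply Real.Gamma_ne_zero
        intro m h
        exact hνnonint m (by push_cast; linarith)
      have hG2 : Real.Gamma (1 / 2) ≠ 0 := (Real.Gamma_pos_of_pos (by norm_num)).ne'
      have hG3 : Real.Gamma (l + 1) ≠ 0 := (Real.Gamma_pos_of_pos (by positivity)).ne'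
      have hG4 : Real.Gamma (l + 3 / 2 + ν) ≠ 0 := (Real.Gamma_pos_of_pos (by positivity)).ne'
      have hu0 : uu ν l hl 0 ≠ 0 := by
        have := (jj_zero_pos ν l hν hl).ne'
        unfold uu cc
        simp [this, hG3]
      exact mul_ne_zero hu0 (div_ne_zero (mul_ne_zero hG3 hG4) (mul_ne_zero hG1 hG2))
    have h2E : (2 : ℝ) ^ E ≠ 0 := (Real.rpow_pos_of_pos (by norm_num) _).ne'
    refine ⟨S * (L * 2 ^ E), mul_ne_zero hS0 (mul_ne_zero hL0 h2E), ?_, ?_⟩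
    · apply tendsto_inf_of_seq _ _ _ 3
      · rintro k ⟨n, rfl⟩ hk
        exact ⟨n - 1, by omega⟩
      · have h3 := lin_ratio 2 3 E hE0 (by norm_num) (by norm_num)
        have h4 : Tendsto (fun n : ℕ => (2 * (n : ℝ) + 3) / (2 * n + 5 + 2 * l + 2 * ν))
            atTop (𝓝 1) := by
          have h5 : Tendsto (fun n : ℕ => (2 + 3 / (n : ℝ)) / (2 + (5 + 2 * l + 2 * ν) / n))
              atTop (𝓝 ((2 + 0) / (2 + 0))) :=
            (tendsto_const_nhds.add (tendsto_const_div_atTop_nhds_zero_nat _)).div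
              (tendsto_const_nhds.add (tendsto_const_div_atTop_nhds_zero_nat _)) (by norm_num)
          have h6 : ((2 : ℝ) + 0) / (2 + 0) = 1 := by norm_num
          rw [h6] at h5
          refine h5.congr' ?_
          filter_upwards [eventually_gt_atTop 0] with n hn
          have hn' : (0 : ℝ) < n := by exact_mod_cast hn
          have hq : 2 * (n : ℝ) + 5 + 2 * l + 2 * ν ≠ 0 := by positivity
          have hq' : 2 + (5 + 2 * l + 2 * ν) / (n : ℝ) ≠ 0 := by positivity
          rw [div_eq_div_iff hq' hq]
          field_simp
          ring
        have h7 := ((hlim.mul h3).mul h4).const_mul S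
        rw [mul_one] at h7
        refine h7.congr' ?_
        filter_upwards [eventually_gt_atTop 0] with n hn
        have hn' : (0 : ℝ) < n := by exact_mod_cast hn
        have hnE : (n : ℝ) ^ E ≠ 0 := (Real.rpow_pos_of_pos hn' _).ne'
        have e1 := vv_succ ν l hν hl (2 * (n + 1))
        rw [show 2 * n + 3 = 2 * (n + 1) + 1 by ring, e1]
        push_cast
        have e2 : 2 * ((n : ℝ) + 1) + 1 = 2 * n + 3 := by ring
        have e3 : 2 * ((n : ℝ) + 1) + 3 + 2 * l + 2 * ν = 2 * n + 5 + 2 * l + 2 * ν := by ring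
        rw [e2, e3]
        field_simp
    · apply tendsto_inf_of_seq _ _ _ 2
      · rintro k ⟨n, rfl⟩ hk
        exact ⟨n - 1, by omega⟩
      · have h3 := lin_ratio 2 2 E hE0 (by norm_num) (by norm_num)
        refine ((hlim.mul h3).const_mul S).congr' ?_
        filter_upwards [eventually_gt_atTop 0] with n hn
        have hn' : (0 : ℝ) < n := by exact_mod_cast hn
        have hnE : (n : ℝ) ^ E ≠ 0 := (Real.rpow_pos_of_pos hn' _).ne'
        rw [show 2 * n + 2 = 2 * (n + 1) by ring]
        push_cast
        have e2 : 2 * ((n : ℝ) + 1) = 2 * n + 2 := by ring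
        rw [e2]
        field_simp
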